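/- arXiv:1211.5380 — 4 statements merged into one kernel-verified Lean document; each statement's English description precedes it below -/
import Mathlib

section
/- Let K ≥ 1 and let N, M : Fin K → ℤ be antenna counts with N i ≥ 1 and M i ≥ 1 for all i. Then the Yetis proper condition holds (i.e., for every subset I of J = {(i,j) ∈ Fin K × Fin K : i ≠ j} one has |I| ≤ ∑_{i ∈ RX(I)} (N i − 1) + ∑_{j ∈ TX(I)} (M j − 1), where RX(I) and TX(I) are the images of I under the first and second projections) if and only if the rectangular proper condition holds (i.e., for every pair of subsets S_RX, S_TX ⊆ Fin K one has NVar(S_RX, S_TX) ≥ NEq(S_RX, S_TX)). -/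
open Finset

/-- Number of variables stemming from the subset of RXs `SRX` and TXs `STX`. -/
def NVar {K : ℕ} (N M : Fin K → ℤ) (SRX STX : Finset (Fin K)) : ℤ :=
  (∑ i ∈ SRX, (N i - 1)) + ∑ j ∈ STX, (M j - 1)

/-- Number of IA equations stemming from the subset of RXs `SRX` and TXs `STX`. -/
def NEq {K : ℕ} (SRX STX : Finset (Fin K)) : ℤ :=
  (((SRX ×ˢ STX).filter fun p => p.1 ≠ p.2).card : ℤ)

/-- The Yetis proper condition is equivalent to the rectangular proper condition. -/
theorem yetis_iff_rectangular_proper (K : ℕ) (hK : 1 ≤ K) (N M : Fin K → ℤ)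
    (hN : ∀ i, 1 ≤ N i) (hM : ∀ i, 1 ≤ M i) :
    (∀ I ⊆ (Finset.univ.filter fun p : Fin K × Fin K => p.1 ≠ p.2),
        (I.card : ℤ) ≤ (∑ i ∈ I.image Prod.fst, (N i - 1)) +
          ∑ j ∈ I.image Prod.snd, (M j - 1)) ↔
    (∀ SRX STX : Finset (Fin K), NVar N M SRX STX ≥ NEq SRX STX) := by
  constructor
  · intro h SRX STX
    refine (h ((SRX ×ˢ STX).filter fun p => p.1 ≠ p.2)
      (filter_subset_filter _ (subset_univ _))).trans (add_le_add ?_ ?_)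
    · refine sum_le_sum_of_subset_of_nonneg ?_ fun i _ _ => sub_nonneg.2 (hN i)
      exact image_subset_iff.2 fun p hp => (mem_product.1 (mem_filter.1 hp).1).1
    · refine sum_le_sum_of_subset_of_nonneg ?_ fun i _ _ => sub_nonneg.2 (hM i)
      exact image_subset_iff.2 fun p hp => (mem_product.1 (mem_filter.1 hp).1).2
  · intro h I hI
    refine le_trans ?_ (h (I.image Prod.fst) (I.image Prod.snd))
    exact Nat.cast_le.2 (card_le_card fun p hp => mem_filter.2
      ⟨mem_product.2 ⟨mem_image_of_mem _ hp, mem_image_of_mem _ hp⟩, (mem_filter.1 (hI hp)).2⟩)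
end

section
/- Let K ≥ 2 and let N, M : Fin K → ℤ with N i ≥ 1 and M i ≥ 1 for all i. Suppose the configuration is proper (NVar(S_RX, S_TX) ≥ NEq(S_RX, S_TX) for all subsets S_RX, S_TX ⊆ Fin K) and ∑_{i=1}^{K} (N i + M i) = K(K+1). Then removing a single antenna destroys properness: for every index j, the configuration obtained by replacing M j with M j − 1 (all other antenna counts unchanged) is not proper, and likewise for every index i, the configuration obtained by replacing N i with N i − 1 is not proper. -/
open Finset

/-- The configuration `(N, M)` is proper. -/
def Proper {K : ℕ} (N M : Fin K → ℤ) : Prop :=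
  ∀ SRX STX : Finset (Fin K), NVar N M SRX STX ≥ NEq SRX STX

theorem NEq_univ (K : ℕ) :
    NEq (univ : Finset (Fin K)) univ = (K : ℤ) * K - K := by
  have h : (((univ : Finset (Fin K)) ×ˢ (univ : Finset (Fin K))).filter
      fun p => p.1 ≠ p.2) = (univ : Finset (Fin K)).offDiag := by
    ext p
    simp
  rw [NEq, h, offDiag_card, card_univ, Fintype.card_fin, Nat.cast_sub (Nat.le_mul_self K)]
  push_cast
  rfl

theorem NVar_univ {K : ℕ} (N M : Fin K → ℤ) :
    NVar N M univ univ = ∑ i, N i + ∑ j, M j - 2 * K := by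
  simp only [NVar, sum_sub_distrib, sum_const, card_univ, Fintype.card_fin, nsmul_eq_mul, mul_one]
  ring

theorem sum_update_sub_one {ι : Type*} [Fintype ι] [DecidableEq ι] (f : ι → ℤ) (i : ι) :
    ∑ k, Function.update f i (f i - 1) k = ∑ k, f k - 1 := by
  have h := sum_sdiff (f := f) (subset_univ {i})
  rw [sum_singleton] at h
  rw [sum_update_of_mem (mem_univ i)]
  linarith

theorem not_proper_of_sum_lt {K : ℕ} {N M : Fin K → ℤ}
    (h : ∑ i, N i + ∑ j, M j < (K : ℤ) * (K + 1)) : ¬ Proper N M := by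
  intro hp
  have := hp univ univ
  rw [NEq_univ, NVar_univ] at this
  linarith

/-- In a tightly-feasible setting, removing any single antenna at any TX or RX destroys
properness. -/
theorem tightly_feasible_remove_antenna (K : ℕ) (hK : 2 ≤ K) (N M : Fin K → ℤ)
    (hN : ∀ i, 1 ≤ N i) (hM : ∀ i, 1 ≤ M i)
    (hproper : Proper N M)
    (htight : (∑ i, (N i + M i)) = (K : ℤ) * (K + 1)) :
    (∀ j : Fin K, ¬ Proper N (Function.update M j (M j - 1))) ∧
    (∀ i : Fin K, ¬ Proper (Function.update N i (N i - 1)) M) := by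
  rw [sum_add_distrib] at htight
  constructor <;> intro k <;> apply not_proper_of_sum_lt <;> rw [sum_update_sub_one] <;> linarith
end

section
/- (Corollary 1.) Let K ≥ 1 and let integers M ≥ 1, N ≥ 1 satisfy M + N = K + 1, M ≠ 1 and M ≠ K (homogeneous tightly-feasible configuration with N i = N and M i = M for all i). Then there is no generalized tightly-feasible sub-interference-channel strictly included in the full channel: for every pair of subsets S_RX, S_TX ⊆ Fin K, if NVar(S_RX, S_TX) = NEq(S_RX, S_TX) (where NVar(S_RX, S_TX) = |S_RX|(N − 1) + |S_TX|(M − 1) and NEq(S_RX, S_TX) = |{(i,j) : i ∈ S_RX, j ∈ S_TX, i ≠ j}|), then either S_RX = S_TX = ∅ or S_RX = S_TX = Fin K. -/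
open Finset

/-- The diagonal pairs of `SRX ×ˢ STX` are counted by `SRX ∩ STX`. -/
theorem NEq_eq_card_mul_card_sub_card_inter {K : ℕ} (SRX STX : Finset (Fin K)) :
    NEq SRX STX = SRX.card * STX.card - (SRX ∩ STX).card := by
  have hdiag : ((SRX ×ˢ STX).filter fun p => p.1 = p.2).card = (SRX ∩ STX).card := by
    have himage : (SRX ×ˢ STX).filter (fun p => p.1 = p.2) =
        (SRX ∩ STX).image fun i => (i, i) := by
      ext ⟨i, j⟩
      simp only [mem_filter, mem_product, mem_image, mem_inter, Prod.mk.injEq]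
      grind
    rw [himage, card_image_of_injective _ fun i j h => congrArg Prod.fst h]
  have hsplit := card_filter_add_card_filter_not (s := SRX ×ˢ STX) fun p => p.1 = p.2
  rw [hdiag, card_product] at hsplit
  unfold NEq
  zify at hsplit
  simp only [ne_eq]
  linarith

/-- The integer solutions of the tightness equation `r * a + t * b = r * t - c`, where `c` is at
least the smallest possible intersection size of sets of cardinalities `r` and `t`. -/
theorem eq_zero_or_eq_of_tight {a b r t c : ℤ} (ha : 1 ≤ a) (hb : 1 ≤ b)
    (hr : 0 ≤ r) (ht : 0 ≤ t) (hrk : r ≤ a + b + 1) (htk : t ≤ a + b + 1)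
    (hc : 0 ≤ c) (hc' : r + t - (a + b + 1) ≤ c) (h : r * a + t * b = r * t - c) :
    (r = 0 ∧ t = 0) ∨ (r = a + b + 1 ∧ t = a + b + 1) := by
  have hprod : (r - b) * (t - a) = a * b + c := by linarith
  have hpos : 0 < (r - b) * (t - a) := by nlinarith
  rcases pos_and_pos_or_neg_and_neg_of_mul_pos hpos with ⟨hx, hy⟩ | ⟨hx, hy⟩
  · right
    have hp : (a + b + 1 - r) * (a + b + 1 - t) ≥
        (a + b + 1 - r) * b + (a + b + 1 - t) * a := by linarith
    have hp₁ : 0 ≤ (a + b + 1 - r) * (t - a - 1) :=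
      mul_nonneg (by linarith) (by linarith)
    have hp₂ : 0 ≤ (a + b + 1 - t) * (r - b - 1) :=
      mul_nonneg (by linarith) (by linarith)
    constructor <;> nlinarith
  · left
    have h₁ : 0 ≤ r * (a - t) := mul_nonneg hr (by linarith)
    have h₂ : 0 ≤ t * (b - r) := mul_nonneg ht (by linarith)
    constructor <;> nlinarith

/-- Corollary 1: in the homogeneous tightly-feasible `[(N,M)^K]` IC with `M ≠ 1` and
`M ≠ K`, there is no generalized tightly-feasible sub-IC strictly included in the IC. -/
theorem no_strict_tight_subIC_homogeneous (K : ℕ) (hK : 1 ≤ K) (M N : ℤ)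
    (hM : 1 ≤ M) (hN : 1 ≤ N) (hMN : M + N = (K : ℤ) + 1)
    (hM1 : M ≠ 1) (hMK : M ≠ (K : ℤ)) :
    ∀ SRX STX : Finset (Fin K),
      (SRX.card : ℤ) * (N - 1) + (STX.card : ℤ) * (M - 1) = NEq SRX STX →
      (SRX = ∅ ∧ STX = ∅) ∨ (SRX = Finset.univ ∧ STX = Finset.univ) := by
  intro SRX STX h
  have hRX : SRX.card ≤ K := card_finset_fin_le SRX
  have hTX : STX.card ≤ K := card_finset_fin_le STX
  have hunion := card_union_add_card_inter SRX STX
  have hunion_le := card_finset_fin_le (SRX ∪ STX)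
  rw [NEq_eq_card_mul_card_sub_card_inter] at h
  rcases eq_zero_or_eq_of_tight (by omega) (by omega) (by omega) (by omega) (by omega) (by omega)
    (by omega) (by omega) h with ⟨hr, ht⟩ | ⟨hr, ht⟩
  · exact .inl ⟨card_eq_zero.mp (by omega), card_eq_zero.mp (by omega)⟩
  · have heq_univ (S : Finset (Fin K)) (hS : S.card = K) : S = univ :=
      (card_eq_iff_eq_univ S).mp (by rw [hS, Fintype.card_fin])
    exact .inr ⟨heq_univ _ (by omega), heq_univ _ (by omega)⟩
end

section
/- Let K ≥ 1 and let N, M : Fin K → ℤ with N i ≥ 1 and M i ≥ 1 for all i. Suppose the configuration is proper (NVar(S_RX, S_TX) ≥ NEq(S_RX, S_TX) for all subsets S_RX, S_TX ⊆ Fin K), and suppose the pair (S_RX, S_TX) is tight, i.e., NVar(S_RX, S_TX) = NEq(S_RX, S_TX). Then for every S'_RX ⊆ Fin K with S'_RX ∩ S_RX = ∅ and every S'_TX ⊆ Fin K with S'_TX ∩ S_TX = ∅, one has NVar(S'_RX, S'_TX) ≥ NEq(S_RX, S'_TX) + NEq(S'_RX, S_TX) + NEq(S'_RX, S'_TX).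 -/
open Finset

theorem NVar_union {K : ℕ} (N M : Fin K → ℤ) {A A' B B' : Finset (Fin K)}
    (hA : Disjoint A A') (hB : Disjoint B B') :
    NVar N M (A ∪ A') (B ∪ B') = NVar N M A B + NVar N M A' B' := by
  simp only [NVar, sum_union hA, sum_union hB]
  ring

theorem NEq_union_left {K : ℕ} {A A' : Finset (Fin K)} (B : Finset (Fin K))
    (hA : Disjoint A A') : NEq (A ∪ A') B = NEq A B + NEq A' B := by
  unfold NEq
  rw [union_product, filter_union, card_union_of_disjoint, Nat.cast_add]
  exact disjoint_filter_filter (disjoint_product.2 (Or.inl hA))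

theorem NEq_union_right {K : ℕ} (A : Finset (Fin K)) {B B' : Finset (Fin K)}
    (hB : Disjoint B B') : NEq A (B ∪ B') = NEq A B + NEq A B' := by
  unfold NEq
  rw [product_union, filter_union, card_union_of_disjoint, Nat.cast_add]
  exact disjoint_filter_filter (disjoint_product.2 (Or.inr hB))

/-- Combinatorial core of Theorem 3: after fixing beamformers in a tight sub-IC
`(SRX, STX)`, the remaining variables still suffice for all remaining equations. -/
theorem remaining_vars_suffice (K : ℕ) (hK : 1 ≤ K) (N M : Fin K → ℤ)
    (hN : ∀ i, 1 ≤ N i) (hM : ∀ i, 1 ≤ M i)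
    (hproper : ∀ A B : Finset (Fin K), NVar N M A B ≥ NEq A B)
    (SRX STX : Finset (Fin K))
    (htight : NVar N M SRX STX = NEq SRX STX) :
    ∀ SRX' STX' : Finset (Fin K), SRX' ∩ SRX = ∅ → STX' ∩ STX = ∅ →
      NVar N M SRX' STX' ≥ NEq SRX STX' + NEq SRX' STX + NEq SRX' STX' := by
  intro A B hA hB
  have hA' : Disjoint SRX A := (disjoint_iff_inter_eq_empty.2 hA).symm
  have hB' : Disjoint STX B := (disjoint_iff_inter_eq_empty.2 hB).symm
  have h := hproper (SRX ∪ A) (STX ∪ B)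
  rw [NVar_union N M hA' hB', NEq_union_left _ hA', NEq_union_right _ hB',
    NEq_union_right _ hB'] at h
  linarith
end
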